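/- Let γ : [t₀,∞) → ℝ be continuously differentiable with γ(t) ≥ K/t for all t ≥ t₀, K > 3, and ∫_{t₀}^{∞} max((t·γ(t))', 0) dt < +∞. Let x : [t₀,∞) → H solve x''(t) + γ(t)·x'(t) + ∇Φ(x(t)) = 0. Then ∫_{t₀}^{∞} s·W(s) ds < +∞, where W(t) = ½‖x'(t)‖² + Φ(x(t)) − min Φ; in particular ∫_{t₀}^{∞} s·‖x'(s)‖² ds < +∞. -/

import Mathlib

open Filter MeasureTheory Set

/-- The gradient inequality for a differentiable convex function. -/
lemma ConvexOn.sub_le_inner_gradient {H : Type*} [NormedAddCommGroup H] [InnerProductSpace ℝ H]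
    [CompleteSpace H] {Φ : H → ℝ} (hconv : ConvexOn ℝ univ Φ) {p : H}
    (hdiff : DifferentiableAt ℝ Φ p) (q : H) :
    Φ p - Φ q ≤ inner ℝ (p - q) (gradient Φ p) := by
  have hc : ConvexOn ℝ univ (Φ ∘ AffineMap.lineMap (k := ℝ) p q) := by
    simpa using hconv.comp_affineMap (AffineMap.lineMap (k := ℝ) p q)
  have hp : HasFDerivAt Φ (fderiv ℝ Φ p) (AffineMap.lineMap (k := ℝ) p q (0 : ℝ)) := by
    simpa using hdiff.hasFDerivAt
  have hd := hp.comp_hasDerivAt (0 : ℝ) AffineMap.hasDerivAt_lineMap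
  have h := hc.le_slope_of_hasDerivAt (mem_univ 0) (mem_univ 1) one_pos hd
  rw [← toDual_gradient, InnerProductSpace.toDual_apply_apply, slope_def_field] at h
  simp only [Function.comp_apply, AffineMap.lineMap_apply_one, AffineMap.lineMap_apply_zero,
    sub_zero, div_one] at h
  rw [real_inner_comm, ← neg_sub q p, inner_neg_right]
  linarith

/-- A nonnegative function dominated by minus the derivative of a nonnegative function is
integrable. -/
lemma integrableOn_Ici_of_hasDerivWithinAt_le_neg {G G' g : ℝ → ℝ} {a : ℝ}
    (hG : ∀ t ∈ Ici a, HasDerivWithinAt G (G' t) (Ici a) t) (hG0 : ∀ t ∈ Ici a, 0 ≤ G t)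
    (hg : ContinuousOn g (Ici a)) (hg0 : ∀ t ∈ Ici a, 0 ≤ g t)
    (hle : ∀ t ∈ Ici a, G' t ≤ -g t) : IntegrableOn g (Ici a) := by
  rw [integrableOn_Ici_iff_integrableOn_Ioi]
  have hint (b : ℝ) : IntegrableOn g (Icc a b) :=
    (hg.mono Icc_subset_Ici_self).integrableOn_compact isCompact_Icc
  refine integrableOn_Ioi_of_intervalIntegral_norm_bounded (l := atTop) (b := id) (G a) a
    (fun b => (hint b).mono_set Ioc_subset_Icc_self) tendsto_id ?_
  filter_upwards [eventually_ge_atTop a] with b hb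
  have h := intervalIntegral.integral_le_sub_of_hasDeriv_right_of_le (g := fun t => -G t)
    (g' := fun t => -G' t) (φ := g) hb
    (fun t ht => ((hG t ht.1).continuousWithinAt.mono Icc_subset_Ici_self).neg)
    (fun t ht => ((hG t ht.1.le).mono fun s hs => ht.1.le.trans (le_of_lt hs)).neg)
    (hint b) (fun t ht => by linarith [hle t ht.1.le])
  have hcongr : ∫ t in a..b, ‖g t‖ = ∫ t in a..b, g t :=
    intervalIntegral.integral_congr fun t ht => by
      rw [uIcc_of_le hb] at ht
      exact Real.norm_of_nonneg (hg0 t ht.1)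
  have := hG0 b hb
  simp only [id]
  linarith

/-- A Grönwall-type criterion: if `E ≥ 0` satisfies `E' ≤ α E - g` with `α, g ≥ 0` and `α`
integrable, then `g` is integrable. -/
lemma integrableOn_Ici_of_gronwall {E E' α g : ℝ → ℝ} {a : ℝ}
    (hE : ∀ t ∈ Ici a, HasDerivWithinAt E (E' t) (Ici a) t) (hE0 : ∀ t ∈ Ici a, 0 ≤ E t)
    (hα : ContinuousOn α (Ici a)) (hα0 : ∀ t ∈ Ici a, 0 ≤ α t) (hαi : IntegrableOn α (Ici a))
    (hg : ContinuousOn g (Ici a)) (hg0 : ∀ t ∈ Ici a, 0 ≤ g t)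
    (hle : ∀ t ∈ Ici a, E' t ≤ α t * E t - g t) : IntegrableOn g (Ici a) := by
  set β : ℝ → ℝ := fun t => α (max a t) with hβ
  have hβc : Continuous β := hα.comp_continuous (by fun_prop) fun t => le_max_left a t
  have hβα : ∀ t ∈ Ici a, β t = α t := fun t ht => by rw [hβ]; simp only [max_eq_right ht.out]
  set A : ℝ → ℝ := fun t => ∫ s in a..t, β s with hA
  have hAd (t : ℝ) : HasDerivAt A (β t) t := (hβc.integral_hasStrictDerivAt a t).hasDerivAt
  set M := ∫ s in Ici a, α s
  have hAM : ∀ t ∈ Ici a, A t ≤ M := fun t ht => by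
    have h1 : A t = ∫ s in Ioc a t, α s := by
      rw [hA]
      simp only [intervalIntegral.integral_of_le ht.out]
      exact setIntegral_congr_fun measurableSet_Ioc fun s hs => hβα s hs.1.le
    rw [h1]
    exact setIntegral_mono_set hαi ((ae_restrict_iff' measurableSet_Ici).2 (.of_forall hα0))
      (Ioc_subset_Icc_self.trans Icc_subset_Ici_self).eventuallyLE
  have hAc : Continuous A := continuous_iff_continuousAt.2 fun t => (hAd t).continuousAt
  have key : IntegrableOn (fun t => Real.exp (-M) * g t) (Ici a) := by
    refine integrableOn_Ici_of_hasDerivWithinAt_le_neg (G := fun t => E t * Real.exp (-A t))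
      (fun t ht => (hE t ht).mul (hAd t).neg.exp.hasDerivWithinAt)
      (fun t ht => mul_nonneg (hE0 t ht) (Real.exp_nonneg _)) (continuousOn_const.mul hg)
      (fun t ht => mul_nonneg (Real.exp_nonneg _) (hg0 t ht)) fun t ht => ?_
    have h1 : Real.exp (-M) * g t ≤ Real.exp (-A t) * g t :=
      mul_le_mul_of_nonneg_right (Real.exp_le_exp.2 (neg_le_neg (hAM t ht))) (hg0 t ht)
    have h2 := mul_le_mul_of_nonneg_right (hle t ht) (Real.exp_nonneg (-A t))
    rw [hβα t ht]
    simp only [Pi.neg_apply]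
    linarith
  refine (key.const_mul (Real.exp M)).congr (.of_forall fun t => ?_)
  simp only
  rw [← mul_assoc, ← Real.exp_add, add_neg_cancel, Real.exp_zero, one_mul]

/-- under the general damping hypotheses, `∫_{t₀}^∞ s W(s) ds < ∞`;
in particular `∫_{t₀}^∞ s ‖x'(s)‖² ds < ∞`. -/
theorem stmt_9 {H : Type*} [NormedAddCommGroup H] [InnerProductSpace ℝ H] [CompleteSpace H]
    (Φ : H → ℝ) (hconv : ConvexOn ℝ Set.univ Φ) (hdiff : ContDiff ℝ 1 Φ)
    (t₀ K : ℝ) (ht₀ : 0 < t₀) (hK : 3 < K)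
    (xstar : H) (hxstar : ∀ y, Φ xstar ≤ Φ y)
    (γ γ' : ℝ → ℝ)
    (hγ' : ∀ t ∈ Set.Ici t₀, HasDerivWithinAt γ (γ' t) (Set.Ici t₀) t)
    (hγ'c : ContinuousOn γ' (Set.Ici t₀))
    (hγK : ∀ t ∈ Set.Ici t₀, K / t ≤ γ t)
    (hγint : MeasureTheory.IntegrableOn (fun t => max (γ t + t * γ' t) 0) (Set.Ici t₀))
    (x x' x'' : ℝ → H)
    (hx' : ∀ t ∈ Set.Ici t₀, HasDerivWithinAt x (x' t) (Set.Ici t₀) t)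
    (hx'' : ∀ t ∈ Set.Ici t₀, HasDerivWithinAt x' (x'' t) (Set.Ici t₀) t)
    (hx''c : ContinuousOn x'' (Set.Ici t₀))
    (heq : ∀ t ∈ Set.Ici t₀, x'' t + γ t • x' t + gradient Φ (x t) = 0)
    (W : ℝ → ℝ) (hW : ∀ t, W t = 1 / 2 * ‖x' t‖ ^ 2 + Φ (x t) - Φ xstar) :
    MeasureTheory.IntegrableOn (fun s => s * W s) (Set.Ici t₀) ∧
    MeasureTheory.IntegrableOn (fun s => s * ‖x' s‖ ^ 2) (Set.Ici t₀) := by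
  set δ := (K - 3) / 2 with hδ
  have hδ0 : 0 < δ := by rw [hδ]; linarith
  have hKδ : K = 3 + 2 * δ := by rw [hδ]; ring
  have hΦd : Differentiable ℝ Φ := hdiff.differentiable one_ne_zero
  have hγc : ContinuousOn γ (Ici t₀) := fun t ht => (hγ' t ht).continuousWithinAt
  have hxc : ContinuousOn x (Ici t₀) := fun t ht => (hx' t ht).continuousWithinAt
  have hx'c : ContinuousOn x' (Ici t₀) := fun t ht => (hx'' t ht).continuousWithinAt
  have hΦc : ContinuousOn (fun t => Φ (x t)) (Ici t₀) := hdiff.continuous.comp_continuousOn hxc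
  have hFd : ∀ t ∈ Ici t₀, HasDerivWithinAt (fun t => Φ (x t))
      (inner ℝ (gradient Φ (x t)) (x' t)) (Ici t₀) t := fun t ht => by
    have h := (hΦd (x t)).hasFDerivAt.comp_hasDerivWithinAt t (hx' t ht)
    rwa [← toDual_gradient, InnerProductSpace.toDual_apply_apply] at h
  have hgc : ContinuousOn (fun t => t * (Φ (x t) - Φ xstar + ‖x' t‖ ^ 2)) (Ici t₀) :=
    continuousOn_id.mul ((hΦc.sub continuousOn_const).add (hx'c.norm.pow 2))
  have hαc : ContinuousOn (fun t => max (γ t + t * γ' t) 0 / δ) (Ici t₀) :=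
    (ContinuousOn.sup (hγc.add (continuousOn_id.mul hγ'c)) continuousOn_const).div_const δ
  have hWc : ContinuousOn (fun t => 1 / 2 * ‖x' t‖ ^ 2 + Φ (x t) - Φ xstar) (Ici t₀) :=
    ((continuousOn_const.mul (hx'c.norm.pow 2)).add hΦc).sub continuousOn_const
  have key : IntegrableOn (fun t => δ * (t * (Φ (x t) - Φ xstar + ‖x' t‖ ^ 2))) (Ici t₀) := by
    have hEd : ∀ t ∈ Ici t₀, HasDerivWithinAt
        (fun t => t ^ 2 * (Φ (x t) - Φ xstar) + 1 / 2 * ‖(2 + δ) • (x t - xstar) + t • x' t‖ ^ 2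
          + (2 + δ) / 2 * ((t * γ t - 3 - δ) * ‖x t - xstar‖ ^ 2)) _ (Ici t₀) t := fun t ht =>
      ((((hasDerivWithinAt_id t _).pow 2).mul ((hFd t ht).sub_const (Φ xstar))).add
        ((((((hx' t ht).sub_const xstar).const_smul (2 + δ)).add
          ((hasDerivWithinAt_id t _).smul (hx'' t ht))).norm_sq).const_mul (1 / 2))).add
        ((((((hasDerivWithinAt_id t _).mul (hγ' t ht)).sub_const 3).sub_const δ).mul
          ((hx' t ht).sub_const xstar).norm_sq).const_mul ((2 + δ) / 2))
    have hElow : ∀ t ∈ Ici t₀, (2 + δ) / 2 * (δ * ‖x t - xstar‖ ^ 2) ≤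
        t ^ 2 * (Φ (x t) - Φ xstar) + 1 / 2 * ‖(2 + δ) • (x t - xstar) + t • x' t‖ ^ 2
          + (2 + δ) / 2 * ((t * γ t - 3 - δ) * ‖x t - xstar‖ ^ 2) := fun t ht => by
      have ht0 : 0 < t := ht₀.trans_le ht
      have hg : K ≤ t * γ t := by
        have := (div_le_iff₀ ht0).1 (hγK t ht)
        linarith
      have h1 : 0 ≤ t ^ 2 * (Φ (x t) - Φ xstar) :=
        mul_nonneg (sq_nonneg t) (sub_nonneg.2 (hxstar _))
      have h2 : 0 ≤ 1 / 2 * ‖(2 + δ) • (x t - xstar) + t • x' t‖ ^ 2 := by positivity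
      have h3 : (2 + δ) / 2 * (δ * ‖x t - xstar‖ ^ 2) ≤
          (2 + δ) / 2 * ((t * γ t - 3 - δ) * ‖x t - xstar‖ ^ 2) := by
        gcongr
        linarith
      linarith
    refine integrableOn_Ici_of_gronwall (α := fun t => max (γ t + t * γ' t) 0 / δ) hEd
      (fun t ht => le_trans (by positivity) (hElow t ht)) hαc
      (fun t _ => by positivity) (hγint.div_const δ) (continuousOn_const.mul hgc) (fun t ht => ?_)
      (fun t ht => ?_)
    · have ht0 : 0 < t := ht₀.trans_le ht
      have := sub_nonneg.2 (hxstar (x t))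
      positivity
    · have ht0 : 0 < t := ht₀.trans_le ht
      have hg : K ≤ t * γ t := by
        have := (div_le_iff₀ ht0).1 (hγK t ht)
        linarith
      have hx2 : x'' t = -(γ t • x' t) - gradient Φ (x t) := by
        have := heq t ht
        rw [← sub_eq_zero, ← this]
        abel
      have hgrad := hconv.sub_le_inner_gradient (hΦd (x t)) xstar
      have hlow := mul_le_mul_of_nonneg_left (hElow t ht)
        (show 0 ≤ max (γ t + t * γ' t) 0 / δ by positivity)
      refine le_trans ?_ (sub_le_sub_right hlow _)
      have hα : max (γ t + t * γ' t) 0 / δ * ((2 + δ) / 2 * (δ * ‖x t - xstar‖ ^ 2)) =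
          (2 + δ) / 2 * (max (γ t + t * γ' t) 0 * ‖x t - xstar‖ ^ 2) := by
        field_simp
      rw [hα]
      have hmax : (2 + δ) / 2 * ((γ t + t * γ' t) * ‖x t - xstar‖ ^ 2) ≤
          (2 + δ) / 2 * (max (γ t + t * γ' t) 0 * ‖x t - xstar‖ ^ 2) := by
        gcongr
        exact le_max_left _ _
      have h1 : (2 + δ) * t * (Φ (x t) - Φ xstar) ≤
          (2 + δ) * t * inner ℝ (x t - xstar) (gradient Φ (x t)) := by
        gcongr
      have h2 : t * ‖x' t‖ ^ 2 * δ ≤ t * ‖x' t‖ ^ 2 * (t * γ t - 3 - δ) := by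
        gcongr
        linarith
      rw [hx2]
      simp only [Pi.add_apply, Pi.smul_apply, Pi.smul_apply', id, inner_add_left, inner_add_right,
        inner_sub_right, inner_neg_right, real_inner_smul_left, real_inner_smul_right,
        real_inner_self_eq_norm_sq, Pi.pow_apply, Pi.mul_apply, one_smul,
        Nat.cast_ofNat, Nat.reduceSub, pow_one, real_inner_comm (x' t) (gradient Φ (x t))]
      linarith
  have hsum : IntegrableOn (fun t => t * (Φ (x t) - Φ xstar + ‖x' t‖ ^ 2)) (Ici t₀) := by
    refine (key.const_mul δ⁻¹).congr (.of_forall fun t => ?_)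
    exact inv_mul_cancel_left₀ hδ0.ne' _
  obtain rfl : W = fun t => 1 / 2 * ‖x' t‖ ^ 2 + Φ (x t) - Φ xstar := funext hW
  constructor
  · refine hsum.mono' ((continuousOn_id.mul hWc).aestronglyMeasurable measurableSet_Ici)
      ((ae_restrict_iff' measurableSet_Ici).2 (.of_forall fun t ht => ?_))
    have ht0 : 0 < t := ht₀.trans_le ht
    have hF := hxstar (x t)
    have hv := sq_nonneg ‖x' t‖
    rw [Real.norm_of_nonneg (mul_nonneg ht0.le (by linarith))]
    gcongr
    linarith
  · refine hsum.mono' ((continuousOn_id.mul (hx'c.norm.pow 2)).aestronglyMeasurable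
        measurableSet_Ici)
      ((ae_restrict_iff' measurableSet_Ici).2 (.of_forall fun t ht => ?_))
    have ht0 : 0 < t := ht₀.trans_le ht
    have hF := hxstar (x t)
    rw [Real.norm_of_nonneg (by positivity)]
    gcongr
    linarith
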